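/- Let d ≥ 1, let β be a positive integer, N = β + 1, K ∈ K(N), and (h_n)_{n≥1} ∈ H. Then: (i) every f in the Hölder class Σ(β) satisfies sup_{n≥1} h_n^{-β} ‖K_{h_n} * f - f‖_∞ < ∞; (ii) every bounded measurable 1-periodic f : ℝ^d → ℝ with sup_{n≥1} h_n^{-β} ‖K_{h_n} * f - f‖_∞ < ∞ belongs to B^β_{∞,∞} in the approximation sense. -/

import Mathlib

open MeasureTheory Real ENNReal

noncomputable section

/-- The rescaled kernel `K_h(t) = h^{-d} K(t/h)`. -/
def resKer (d : ℕ) (K : EuclideanSpace ℝ (Fin d) → ℝ) (h : ℝ) :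
    EuclideanSpace ℝ (Fin d) → ℝ :=
  fun t => (h ^ d)⁻¹ * K (h⁻¹ • t)

/-- Convolution `(g * f)(t) = ∫ g(t-u) f(u) du` on `ℝ^d`. -/
def convol (d : ℕ) (g f : EuclideanSpace ℝ (Fin d) → ℝ) :
    EuclideanSpace ℝ (Fin d) → ℝ :=
  fun t => ∫ u, g (t - u) * f u

/-- The sup-norm `‖f‖_∞` (essential supremum of `|f|` over `ℝ^d`), with values in `ℝ≥0∞`. -/
def supNorm (d : ℕ) (f : EuclideanSpace ℝ (Fin d) → ℝ) : ℝ≥0∞ :=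
  eLpNorm f ⊤ volume

/-- `f` is 1-periodic: `f(x + e_i) = f(x)` for every standard basis vector `e_i`. -/
def Per1 (d : ℕ) (f : EuclideanSpace ℝ (Fin d) → ℝ) : Prop :=
  ∀ x (i : Fin d), f (x + EuclideanSpace.single i 1) = f x

/-- `f` is bounded and measurable. -/
def BddMeas (d : ℕ) (f : EuclideanSpace ℝ (Fin d) → ℝ) : Prop :=
  Measurable f ∧ ∃ M, ∀ x, |f x| ≤ M

/-- The partial derivative `∂f/∂t_i`. -/
def pderiv1 (d : ℕ) (i : Fin d) (f : EuclideanSpace ℝ (Fin d) → ℝ) :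
    EuclideanSpace ℝ (Fin d) → ℝ :=
  fun x => fderiv ℝ f x (EuclideanSpace.single i 1)

/-- The partial derivative `∂^α f = ∂^{α_1}_{t_1} ⋯ ∂^{α_d}_{t_d} f` for a multi-index `α`. -/
def pderivM (d : ℕ) (α : Fin d → ℕ) (f : EuclideanSpace ℝ (Fin d) → ℝ) :
    EuclideanSpace ℝ (Fin d) → ℝ :=
  (List.finRange d).foldr (fun i g => (pderiv1 d i)^[α i] g) f

/-- The kernel class `K(N)`: conditions (A1)–(A6) of the paper. -/
def KernelClass (d N : ℕ) (K : EuclideanSpace ℝ (Fin d) → ℝ) : Prop :=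
  -- (A1) compact support
  HasCompactSupport K ∧
  -- (A2) square-integrable
  Integrable (fun u => K u ^ 2) ∧
  -- (A3) L² increment bound
  (∃ C > 0, ∃ γ ∈ Set.Ioc (0 : ℝ) 1, ∀ t : EuclideanSpace ℝ (Fin d), ‖t‖ ≤ 1 →
    ∫ u, (K (t + u) - K u) ^ 2 ≤ C * ‖t‖ ^ (2 * γ)) ∧
  -- (A4) unit mass
  (∫ u, K u) = 1 ∧
  -- (A5) smoothness and integrable partial derivatives up to order N
  (ContDiff ℝ N K ∧ ∀ α : Fin d → ℕ, (∑ i, α i) ≤ N →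
    Integrable (fun t => |pderivM d α K t|)) ∧
  -- (A6) vanishing moments
  (∀ α : Fin d → ℕ, 1 ≤ (∑ i, α i) → (∑ i, α i) ≤ N →
    ∫ u, (∏ i, u i ^ α i) * K u = 0)

/-- The bandwidth class `H`: `h_n = 2^{-m_n}` with `(m_n)` nondecreasing positive integers
tending to `∞` and with bounded increments. -/
def BandClass (h : ℕ → ℝ) : Prop :=
  ∃ m : ℕ → ℕ, (∀ n, 0 < m n) ∧ Monotone m ∧
    Filter.Tendsto m Filter.atTop Filter.atTop ∧
    (∃ B : ℕ, ∀ n, m (n + 1) - m n ≤ B) ∧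
    ∀ n, h n = (2 : ℝ) ^ (-(m n : ℝ))

/-- `f` belongs to the Besov space `B^β_{∞,∞}` in the approximation sense: there are bounded
1-periodic `C^N` functions `f_j` with `sup_j 2^{jβ} ‖f - f_j‖_∞ < ∞` and
`sup_j 2^{-(N-β)j} ‖∂^α f_j‖_∞ < ∞` for every multi-index `α` with `|α| = N`. -/
def MemBesov (d : ℕ) (β : ℝ) (N : ℕ) (f : EuclideanSpace ℝ (Fin d) → ℝ) : Prop :=
  ∃ fs : ℕ → EuclideanSpace ℝ (Fin d) → ℝ,
    (∀ j, 1 ≤ j → (∃ M, ∀ x, |fs j x| ≤ M) ∧ Per1 d (fs j) ∧ ContDiff ℝ N (fs j)) ∧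
    (∃ C : ℝ, ∀ j : ℕ, 1 ≤ j →
      supNorm d (fun x => f x - fs j x) ≤ ENNReal.ofReal (C * 2 ^ (-(j : ℝ) * β))) ∧
    (∃ C : ℝ, ∀ α : Fin d → ℕ, (∑ i, α i) = N → ∀ j : ℕ, 1 ≤ j →
      supNorm d (pderivM d α (fs j)) ≤ ENNReal.ofReal (C * 2 ^ (((N : ℝ) - β) * j)))

/-- The Hölder class `Σ(β)`: `f` is a bounded 1-periodic function of class `C^m`
(`m` the largest integer strictly less than `β`) all of whose partial derivatives of order `m`
are `(β-m)`-Hölder. -/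
def HolderSigma (d : ℕ) (β : ℝ) (f : EuclideanSpace ℝ (Fin d) → ℝ) : Prop :=
  ∃ m : ℕ, (m : ℝ) < β ∧ β ≤ (m : ℝ) + 1 ∧
    ContDiff ℝ m f ∧ (∃ M, ∀ x, |f x| ≤ M) ∧ Per1 d f ∧
    ∀ σ : Fin d → ℕ, (∑ i, σ i) = m → ∃ C : ℝ, ∀ x y,
      |pderivM d σ f x - pderivM d σ f y| ≤ C * ‖x - y‖ ^ (β - (m : ℝ))

end

local notation "𝔼" => EuclideanSpace ℝ

section PartialDerivatives

variable {d : ℕ}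

/-- The iterated partial derivative along a list of coordinate directions. -/
noncomputable def pderivL (l : List (Fin d)) (f : 𝔼 (Fin d) → ℝ) : 𝔼 (Fin d) → ℝ :=
  l.foldr (pderiv1 d) f

/-- The sorted list of directions in which `i` occurs `α i` times. -/
def directionList (α : Fin d → ℕ) : List (Fin d) :=
  (List.finRange d).flatMap fun i => List.replicate (α i) i

lemma count_directionList (α : Fin d → ℕ) (i : Fin d) : (directionList α).count i = α i := by
  classical
  simp only [directionList, List.count_flatMap, Function.comp_def, List.count_replicate]
  rw [← List.sum_toFinset _ (List.nodup_finRange d)]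
  simp

lemma length_directionList (α : Fin d → ℕ) : (directionList α).length = ∑ i, α i := by
  simp [directionList, List.length_flatMap, Fin.sum_univ_def]

lemma pderivM_eq_pderivL (α : Fin d → ℕ) (f : 𝔼 (Fin d) → ℝ) :
    pderivM d α f = pderivL (directionList α) f := by
  have replicate_case : ∀ (n : ℕ) (i : Fin d) (g : 𝔼 (Fin d) → ℝ),
      (pderiv1 d i)^[n] g = (List.replicate n i).foldr (pderiv1 d) g := by
    intro n i g
    induction n with
    | zero => rfl
    | succ n ih => rw [Function.iterate_succ_apply', ih, List.replicate_succ, List.foldr_cons]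
  unfold pderivM pderivL directionList
  induction List.finRange d with
  | nil => rfl
  | cons i l ih =>
    rw [List.foldr_cons, ih, List.flatMap_cons, List.foldr_append, replicate_case]

lemma sum_count_eq_length (l : List (Fin d)) : ∑ i, l.count i = l.length := by
  simpa using Multiset.sum_count_eq_card (s := Finset.univ) (m := (l : Multiset (Fin d)))
    (fun a _ => Finset.mem_univ a)

lemma directionList_count_perm (l : List (Fin d)) :
    (directionList fun i => l.count i).Perm l := by
  classical
  exact List.perm_iff_count.2 fun i => count_directionList _ i

lemma ContDiff.pderiv1 {n : ℕ} {f : 𝔼 (Fin d) → ℝ} (hf : ContDiff ℝ (n + 1 : ℕ) f) (i : Fin d) :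
    ContDiff ℝ n (pderiv1 d i f) :=
  (hf.fderiv_right (m := n) (by norm_cast)).clm_apply contDiff_const

lemma ContDiff.pderivL {n : ℕ} {f : 𝔼 (Fin d) → ℝ} {l : List (Fin d)}
    (hf : ContDiff ℝ (n + l.length : ℕ) f) : ContDiff ℝ n (pderivL l f) := by
  induction l generalizing n with
  | nil => exact hf
  | cons i l ih =>
    refine ContDiff.pderiv1 (ih ?_) i
    convert hf using 2
    simp only [List.length_cons]
    ring

lemma HasCompactSupport.pderiv1 {f : 𝔼 (Fin d) → ℝ} (hf : HasCompactSupport f) (i : Fin d) :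
    HasCompactSupport (pderiv1 d i f) :=
  (hf.fderiv ℝ).comp_left (g := fun L : 𝔼 (Fin d) →L[ℝ] ℝ => L (EuclideanSpace.single i 1)) rfl

lemma HasCompactSupport.pderivL {f : 𝔼 (Fin d) → ℝ} (hf : HasCompactSupport f)
    (l : List (Fin d)) : HasCompactSupport (pderivL l f) := by
  induction l with
  | nil => exact hf
  | cons i l ih => exact HasCompactSupport.pderiv1 ih i

lemma pderiv1_comm {f : 𝔼 (Fin d) → ℝ} (hf : ContDiff ℝ 2 f) (i j : Fin d) :
    pderiv1 d i (pderiv1 d j f) = pderiv1 d j (pderiv1 d i f) := by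
  have second : ∀ (a b : Fin d) (x : 𝔼 (Fin d)), pderiv1 d a (pderiv1 d b f) x =
      fderiv ℝ (fderiv ℝ f) x (EuclideanSpace.single a 1) (EuclideanSpace.single b 1) := by
    intro a b x
    have hd : DifferentiableAt ℝ (fderiv ℝ f) x :=
      ((hf.fderiv_right (m := 1) (by norm_num)).differentiable (by norm_num)) x
    have := hd.hasFDerivAt.clm_apply (hasFDerivAt_const (EuclideanSpace.single b (1 : ℝ)) x)
    change fderiv ℝ (fun y => fderiv ℝ f y (EuclideanSpace.single b 1)) x _ = _
    rw [this.fderiv]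
    simp
  funext x
  rw [second, second]
  exact (hf.contDiffAt.isSymmSndFDerivAt (by simp)) _ _

lemma pderivL_perm {f : 𝔼 (Fin d) → ℝ} {l l' : List (Fin d)} (h : l.Perm l')
    (hf : ContDiff ℝ l.length f) : pderivL l f = pderivL l' f := by
  induction h with
  | nil => rfl
  | cons i _ ih =>
    exact congrArg (pderiv1 d i) (ih (hf.of_le (by simp)))
  | swap i j l =>
    refine pderiv1_comm (ContDiff.pderivL (n := 2) (hf.of_le ?_)) j i
    norm_cast
    simp only [List.length_cons]
    omega
  | trans h₁ _ ih₁ ih₂ => rw [ih₁ hf, ih₂ (h₁.length_eq ▸ hf)]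

lemma pderivL_append (l l' : List (Fin d)) (f : 𝔼 (Fin d) → ℝ) :
    pderivL (l ++ l') f = pderivL l (pderivL l' f) := List.foldr_append

lemma fderiv_apply_eq_sum (f : 𝔼 (Fin d) → ℝ) (x v : 𝔼 (Fin d)) :
    fderiv ℝ f x v = ∑ i, v i * pderiv1 d i f x := by
  conv_lhs => rw [← (EuclideanSpace.basisFun (Fin d) ℝ).sum_repr v]
  simp [map_sum, pderiv1]

end PartialDerivatives

section Taylor

variable {d : ℕ}

lemma hasDerivAt_integral_dilate {W f : 𝔼 (Fin d) → ℝ} (hW : Continuous W)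
    (hWs : HasCompactSupport W) (hf : ContDiff ℝ 1 f) (t : 𝔼 (Fin d)) (s : ℝ) :
    HasDerivAt (fun s : ℝ => ∫ v, W v * f (t - s • v))
      (-∑ i, ∫ v, (v i * W v) * pderiv1 d i f (t - s • v)) s := by
  have hf' : Continuous (fderiv ℝ f) := hf.continuous_fderiv (by norm_num)
  have hg : Continuous fun p : ℝ × 𝔼 (Fin d) => fderiv ℝ f (t - p.1 • p.2) p.2 := by
    fun_prop
  obtain ⟨M, hM⟩ := ((isCompact_closedBall s 1).prod hWs).exists_bound_of_continuousOn
    hg.continuousOn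
  have key := (hasDerivAt_integral_of_dominated_loc_of_deriv_le (μ := volume)
    (F := fun (s : ℝ) v => W v * f (t - s • v))
    (F' := fun (s : ℝ) v => W v * -(fderiv ℝ f (t - s • v) v)) (x₀ := s)
    (bound := fun v => ‖W v‖ * M) (Metric.ball_mem_nhds s one_pos)
    (Filter.Eventually.of_forall fun r => by
      have : Continuous f := hf.continuous
      exact (by fun_prop : Continuous fun v => W v * f (t - r • v)).aestronglyMeasurable)
    ?_ ?_ ?_ ?_ ?_).2
  · refine key.congr_deriv ?_
    rw [← integral_finsetSum, ← integral_neg]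
    · congr 1
      funext v
      rw [fderiv_apply_eq_sum, mul_neg, Finset.mul_sum, neg_inj]
      exact Finset.sum_congr rfl fun i _ => by ring
    · intro i _
      have : Continuous (pderiv1 d i f) :=
        (ContDiff.pderiv1 (n := 0) (by simpa using hf) i).continuous
      refine Continuous.integrable_of_hasCompactSupport (by fun_prop) ?_
      exact (hWs.mul_left (f := fun v : 𝔼 (Fin d) => v i)).mul_right
  · have : Continuous f := hf.continuous
    exact Continuous.integrable_of_hasCompactSupport (by fun_prop) hWs.mul_right
  · exact (by fun_prop : Continuous fun v => W v * -(fderiv ℝ f (t - s • v) v)).aestronglyMeasurable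
  · refine Filter.Eventually.of_forall fun v r hr => ?_
    by_cases hv : v ∈ tsupport W
    · rw [norm_mul, norm_neg]
      exact mul_le_mul_of_nonneg_left (hM (r, v) ⟨Metric.ball_subset_closedBall hr, hv⟩)
        (norm_nonneg _)
    · simp [image_eq_zero_of_notMem_tsupport hv]
  · exact ((hW.integrable_of_hasCompactSupport hWs).norm).mul_const M
  · refine Filter.Eventually.of_forall fun v r _ => ?_
    have h1 : HasDerivAt (fun r : ℝ => t - r • v) (-v) r := by
      simpa using ((hasDerivAt_id r).smul_const v).const_sub t
    have h2 := ((hf.differentiable (by norm_num)) (t - r • v)).hasFDerivAt.comp_hasDerivAt r h1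
    simpa using h2.const_mul (W v)

/-- If the moments of `W` of orders `1, …, m` vanish, then averaging dilates of a `C^m` function
with Lipschitz derivatives of order `m` against `W` has an error of order `s^(m+1)`. -/
lemma exists_integral_dilate_sub_le (m : ℕ) : ∀ (W f : 𝔼 (Fin d) → ℝ), Continuous W →
    HasCompactSupport W →
    (∀ l : List (Fin d), 1 ≤ l.length → l.length ≤ m →
      ∫ v : 𝔼 (Fin d), (l.map fun i => v i).prod * W v = 0) →
    ContDiff ℝ m f →
    (∀ l : List (Fin d), l.length = m → ∃ C : ℝ, ∀ x y,
      |pderivL l f x - pderivL l f y| ≤ C * ‖x - y‖) →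
    ∃ C : ℝ, ∀ t, ∀ s : ℝ, 0 ≤ s → |(∫ v, W v * f (t - s • v)) - (∫ v, W v) * f t| ≤
      C * s ^ (m + 1) := by
  induction m with
  | zero =>
    intro W f hW hWs hmom hf hlip
    obtain ⟨L, hL⟩ := hlip [] rfl
    change ∀ x y, |f x - f y| ≤ L * ‖x - y‖ at hL
    have hf : Continuous f := hf.continuous
    refine ⟨∫ v, ‖W v‖ * (L * ‖v‖), fun t s hs => ?_⟩
    have hsub : (∫ v, W v * f (t - s • v)) - (∫ v, W v) * f t =
        ∫ v, W v * (f (t - s • v) - f t) := by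
      simp_rw [mul_sub]
      rw [integral_sub, integral_mul_const]
      · exact Continuous.integrable_of_hasCompactSupport (by fun_prop) hWs.mul_right
      · exact Continuous.integrable_of_hasCompactSupport (by fun_prop) hWs.mul_right
    rw [hsub, ← integral_mul_const, ← Real.norm_eq_abs]
    refine norm_integral_le_of_norm_le ?_ (Filter.Eventually.of_forall fun v => ?_)
    · exact Continuous.integrable_of_hasCompactSupport (by fun_prop)
        (hWs.norm.mul_right.mul_right)
    · rw [norm_mul, mul_assoc]
      refine mul_le_mul_of_nonneg_left ((hL _ _).trans_eq ?_) (norm_nonneg _)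
      rw [sub_sub_cancel_left, norm_neg, norm_smul, Real.norm_of_nonneg hs]
      ring
  | succ m ih =>
    intro W f hW hWs hmom hf hlip
    have hpart : ∀ i : Fin d, ∃ C : ℝ, ∀ t, ∀ s : ℝ, 0 ≤ s →
        |∫ v, (v i * W v) * pderiv1 d i f (t - s • v)| ≤ C * s ^ (m + 1) := by
      intro i
      have hzero : ∫ v, v i * W v = 0 := by simpa using hmom [i] le_rfl (by simp)
      have hi := ih (fun v => v i * W v) (pderiv1 d i f) (by fun_prop)
        (hWs.mul_left (f := fun v : 𝔼 (Fin d) => v i)) ?_ (hf.pderiv1 i) ?_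
      · simpa only [hzero, zero_mul, sub_zero] using hi
      · intro l _ hl
        rw [← hmom (i :: l) (by simp) (by simpa using hl)]
        congr 1
        funext v
        simp only [List.map_cons, List.prod_cons]
        ring
      · intro l hl
        obtain ⟨C, hC⟩ := hlip (l ++ [i]) (by simp [hl])
        exact ⟨C, by simpa only [pderivL_append] using! hC⟩
    choose C hC using hpart
    refine ⟨∑ i, |C i|, fun t s hs => ?_⟩
    have hCs : 0 ≤ ∑ i, |C i| := Finset.sum_nonneg fun i _ => abs_nonneg _
    have hderiv := hasDerivAt_integral_dilate hW hWs (hf.of_le (by norm_cast; omega)) t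
    have hB : ∀ x : ℝ, HasDerivAt (fun x => (∑ i, |C i|) * x ^ (m + 1 + 1))
        ((∑ i, |C i|) * (((m + 1 + 1 : ℕ) : ℝ) * x ^ (m + 1))) x := fun x => by
      simpa using (hasDerivAt_pow (m + 1 + 1) x).const_mul (∑ i, |C i|)
    refine image_norm_le_of_norm_deriv_right_le_deriv_boundary (a := 0) (b := s)
      (f := fun s : ℝ => (∫ v, W v * f (t - s • v)) - (∫ v, W v) * f t)
      (fun x _ => ((hderiv x).sub_const _).continuousAt.continuousWithinAt)
      (fun x _ => ((hderiv x).sub_const _).hasDerivWithinAt) ?_ hB ?_ (x := s) ⟨hs, le_rfl⟩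
    · simp [integral_mul_const]
    · intro x hx
      rw [norm_neg]
      refine (norm_sum_le _ _).trans ?_
      rw [Finset.sum_mul]
      refine Finset.sum_le_sum fun i _ => (hC i t x hx.1).trans ?_
      have hx' : 0 ≤ x ^ (m + 1) := pow_nonneg hx.1 _
      refine mul_le_mul (le_abs_self _) ?_ hx' (abs_nonneg _)
      exact le_mul_of_one_le_left hx' (Nat.one_le_cast.2 (Nat.le_add_left 1 (m + 1)))

end Taylor

section Convolution

variable {d : ℕ}

lemma convol_resKer_eq (G g : 𝔼 (Fin d) → ℝ) {h : ℝ} (hh : 0 < h) (t : 𝔼 (Fin d)) :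
    convol d (resKer d G h) g t = ∫ v, G v * g (t - h • v) := by
  have hne : h ≠ 0 := hh.ne'
  have h1 := integral_sub_left_eq_self (fun x => G (h⁻¹ • x) * g (t - h • (h⁻¹ • x))) volume t
  have h2 := Measure.integral_comp_smul volume (fun v => G v * g (t - h • v)) h⁻¹
  rw [h2, finrank_euclideanSpace_fin] at h1
  simp only [smul_inv_smul₀ hne, sub_sub_self, smul_eq_mul] at h1
  simp only [convol, resKer, mul_assoc]
  rw [integral_const_mul, h1, inv_pow, inv_inv, abs_of_pos (pow_pos hh d), ← mul_assoc,
    inv_mul_cancel₀ (pow_pos hh d).ne', one_mul]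

lemma convol_eq_convolution (k g : 𝔼 (Fin d) → ℝ) :
    convol d k g = convolution k g (ContinuousLinearMap.mul ℝ ℝ) volume :=
  funext fun _ => convolution_mul_swap.symm

lemma ContDiff.resKer {n : ℕ∞} {G : 𝔼 (Fin d) → ℝ} (hG : ContDiff ℝ n G) (h : ℝ) :
    ContDiff ℝ n (resKer d G h) :=
  contDiff_const.mul (hG.comp (contDiff_const_smul _))

lemma HasCompactSupport.resKer {G : 𝔼 (Fin d) → ℝ} (hG : HasCompactSupport G) {h : ℝ}
    (hh : 0 < h) : HasCompactSupport (resKer d G h) :=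
  HasCompactSupport.mul_left
    (hG.comp_homeomorph (Homeomorph.smulOfNeZero h⁻¹ (inv_ne_zero hh.ne')))

lemma BddMeas.locallyIntegrable {g : 𝔼 (Fin d) → ℝ} (hg : BddMeas d g) : LocallyIntegrable g := by
  obtain ⟨hm, M, hM⟩ := hg
  exact (locallyIntegrable_const M).mono hm.aestronglyMeasurable
    (Filter.Eventually.of_forall fun x => (hM x).trans (le_abs_self M))

lemma contDiff_convol {n : ℕ∞} {k g : 𝔼 (Fin d) → ℝ} (hk : ContDiff ℝ n k)
    (hks : HasCompactSupport k) (hg : LocallyIntegrable g) : ContDiff ℝ n (convol d k g) := by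
  rw [convol_eq_convolution]
  exact hks.contDiff_convolution_left _ hk hg

lemma pderiv1_convol {k g : 𝔼 (Fin d) → ℝ} (hk : ContDiff ℝ 1 k)
    (hks : HasCompactSupport k) (hg : LocallyIntegrable g) (i : Fin d) :
    pderiv1 d i (convol d k g) = convol d (pderiv1 d i k) g := by
  funext t
  have hint := (hks.fderiv ℝ).convolutionExists_left
    ((ContinuousLinearMap.mul ℝ ℝ).precompL (𝔼 (Fin d)))
    (hk.continuous_fderiv (by norm_num)) hg t
  rw [pderiv1, convol_eq_convolution, (hks.hasFDerivAt_convolution_left _ hk hg t).fderiv,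
    convolution, ContinuousLinearMap.integral_apply hint, convol_eq_convolution, convolution]
  simp [pderiv1]

lemma pderiv1_resKer {G : 𝔼 (Fin d) → ℝ} (hG : ContDiff ℝ 1 G) (h : ℝ) (i : Fin d) :
    pderiv1 d i (resKer d G h) = fun t => h⁻¹ * resKer d (pderiv1 d i G) h t := by
  funext t
  have hd : HasFDerivAt (resKer d G h) ((h ^ d)⁻¹ •
      (fderiv ℝ G (h⁻¹ • t)).comp (h⁻¹ • ContinuousLinearMap.id ℝ (𝔼 (Fin d)))) t :=
    (((hG.differentiable (by norm_num)) (h⁻¹ • t)).hasFDerivAt.comp t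
      ((hasFDerivAt_id t).const_smul h⁻¹)).const_mul _
  rw [pderiv1, hd.fderiv]
  simp [resKer, pderiv1]
  ring

lemma pderiv1_const_mul (c : ℝ) (f : 𝔼 (Fin d) → ℝ) (i : Fin d) :
    pderiv1 d i (fun t => c * f t) = fun t => c * pderiv1 d i f t := by
  funext t
  have := fderiv_const_smul_field (𝕜 := ℝ) (f := f) c
  change fderiv ℝ (c • f) t _ = _
  rw [this]
  rfl

lemma pderivL_convol_resKer {g : 𝔼 (Fin d) → ℝ} (hg : LocallyIntegrable g) {h : ℝ} (hh : 0 < h)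
    (l : List (Fin d)) {G : 𝔼 (Fin d) → ℝ} (hG : ContDiff ℝ l.length G)
    (hGs : HasCompactSupport G) :
    pderivL l (convol d (resKer d G h) g) =
      fun t => (h ^ l.length)⁻¹ * convol d (resKer d (pderivL l G) h) g t := by
  induction l with
  | nil => simp [pderivL]
  | cons i l ih =>
    have hl : ContDiff ℝ 1 (pderivL l G) :=
      ContDiff.pderivL (n := 1) (hG.of_le (by norm_cast; simp only [List.length_cons]; omega))
    have hls := (hGs.pderivL l).resKer hh
    change pderiv1 d i (pderivL l _) = _
    rw [ih (hG.of_le (by norm_cast; simp)), pderiv1_const_mul,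
      pderiv1_convol (hl.resKer (n := 1) h) hls hg, pderiv1_resKer hl]
    funext t
    simp only [convol, mul_assoc, integral_const_mul, List.length_cons, pow_succ, mul_inv]
    rfl

lemma integrable_resKer {G : 𝔼 (Fin d) → ℝ} (hG : Continuous G) (hGs : HasCompactSupport G)
    {h : ℝ} (hh : 0 < h) : Integrable (resKer d G h) :=
  (ContDiff.resKer (n := 0) (by simpa using hG) h).continuous.integrable_of_hasCompactSupport
    (hGs.resKer hh)

lemma abs_convol_resKer_le {G g : 𝔼 (Fin d) → ℝ} (hG : Continuous G)
    (hGs : HasCompactSupport G) {M : ℝ} (hg : ∀ᵐ x, |g x| ≤ M) {h : ℝ} (hh : 0 < h)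
    (t : 𝔼 (Fin d)) : |convol d (resKer d G h) g t| ≤ (∫ v, |G v|) * M := by
  have hscale : ∫ u, |resKer d G h (t - u)| * M = (∫ v, |G v|) * M := by
    have := convol_resKer_eq (fun v => |G v|) (fun _ => M) hh t
    rw [integral_mul_const] at this
    rw [← this, convol]
    congr 1
    funext u
    simp [resKer, abs_mul, abs_of_pos hh]
  rw [← hscale, ← Real.norm_eq_abs, convol]
  refine norm_integral_le_of_norm_le ?_ (hg.mono fun u hu => ?_)
  · exact (((integrable_resKer hG hGs hh).comp_sub_left t).norm).mul_const M
  · rw [norm_mul]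
    exact mul_le_mul_of_nonneg_left hu (norm_nonneg _)

lemma bddMeas_convol_resKer {G g : 𝔼 (Fin d) → ℝ} (hG : Continuous G)
    (hGs : HasCompactSupport G) (hg : BddMeas d g) {h : ℝ} (hh : 0 < h) :
    BddMeas d (convol d (resKer d G h) g) := by
  refine ⟨?_, ?_⟩
  · have hc : ContDiff ℝ (0 : ℕ∞) G := by simpa using hG
    exact (contDiff_convol (hc.resKer h) (hGs.resKer hh) hg.locallyIntegrable).continuous.measurable
  · obtain ⟨_, M, hM⟩ := hg
    exact ⟨_, abs_convol_resKer_le hG hGs (Filter.Eventually.of_forall hM) hh⟩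

lemma convol_sub {k f g : 𝔼 (Fin d) → ℝ} (hk : Integrable k) (hf : BddMeas d f)
    (hg : BddMeas d g) (t : 𝔼 (Fin d)) :
    convol d k (fun x => f x - g x) t = convol d k f t - convol d k g t := by
  have hint : ∀ {p : 𝔼 (Fin d) → ℝ}, BddMeas d p → Integrable fun u => k (t - u) * p u :=
    fun ⟨hm, _, hM⟩ => (hk.comp_sub_left t).mul_bdd hm.aestronglyMeasurable
      (Filter.Eventually.of_forall hM)
  simp only [convol, mul_sub]
  exact integral_sub (hint hf) (hint hg)

lemma per1_convol_resKer (G : 𝔼 (Fin d) → ℝ) {g : 𝔼 (Fin d) → ℝ} (hg : Per1 d g) {h : ℝ}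
    (hh : 0 < h) : Per1 d (convol d (resKer d G h) g) := by
  intro x i
  rw [convol_resKer_eq G g hh, convol_resKer_eq G g hh]
  congr 1
  funext v
  rw [add_sub_right_comm, hg]

lemma convol_resKer_comm {G H g : 𝔼 (Fin d) → ℝ} (hG : Integrable G) (hH : Integrable H)
    (hg : BddMeas d g) {a b : ℝ} (ha : 0 < a) (hb : 0 < b) :
    convol d (resKer d G a) (convol d (resKer d H b) g) =
      convol d (resKer d H b) (convol d (resKer d G a) g) := by
  funext t
  obtain ⟨hm, M, hM⟩ := hg
  simp only [convol_resKer_eq _ _ ha, convol_resKer_eq _ _ hb, ← integral_const_mul]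
  rw [integral_integral_swap]
  · congr 1
    funext w
    congr 1
    funext v
    rw [sub_right_comm]
    ring
  · have hprod := (hG.mul_prod hH).mul_bdd (c := M)
      (g := fun p : 𝔼 (Fin d) × 𝔼 (Fin d) => g (t - a • p.1 - b • p.2))
      (by exact (hm.comp (by fun_prop)).aestronglyMeasurable)
      (Filter.Eventually.of_forall fun p => hM _)
    simpa [Function.uncurry_def, mul_assoc] using hprod

end Convolution

section Bandwidths

variable {d : ℕ}

lemma ae_abs_le_of_supNorm_le {f : 𝔼 (Fin d) → ℝ} {C : ℝ} (hC : 0 ≤ C)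
    (hf : supNorm d f ≤ ENNReal.ofReal C) : ∀ᵐ x, |f x| ≤ C := by
  filter_upwards [enorm_ae_le_eLpNormEssSup f volume] with x hx
  have h : ‖f x‖ₑ ≤ ENNReal.ofReal C := by
    rw [supNorm, eLpNorm_exponent_top] at hf
    exact hx.trans hf
  rw [← ofReal_norm, ENNReal.ofReal_le_ofReal_iff hC] at h
  exact h

lemma supNorm_le_of_ae_abs_le {f : 𝔼 (Fin d) → ℝ} {C : ℝ} (hf : ∀ᵐ x, |f x| ≤ C) :
    supNorm d f ≤ ENNReal.ofReal C := by
  rw [supNorm, eLpNorm_exponent_top]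
  exact eLpNormEssSup_le_of_ae_bound hf

/-- A sequence of naturals tending to infinity with bounded increments visits, up to a bounded
excess, every scale. -/
lemma exists_bounded_excess {m : ℕ → ℕ} (hm : Filter.Tendsto m Filter.atTop Filter.atTop)
    {B : ℕ} (hB : ∀ n, m (n + 1) - m n ≤ B) :
    ∃ R : ℕ, ∀ j, ∃ n, 1 ≤ n ∧ j ≤ m n ∧ m n ≤ j + R := by
  classical
  refine ⟨B + m 1, fun j => ?_⟩
  have hex : ∃ n, 1 ≤ n ∧ j ≤ m n :=
    ((Filter.eventually_ge_atTop 1).and (hm.eventually_ge_atTop j)).exists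
  have hspec := Nat.find_spec hex
  have hmin := fun k (hk : k < Nat.find hex) => Nat.find_min hex hk
  set n := Nat.find hex
  refine ⟨n, hspec.1, hspec.2, ?_⟩
  obtain h1 | h1 := hspec.1.eq_or_lt
  · rw [← h1]
    omega
  · have h2 := hmin (n - 1) (by omega)
    have h3 := hB (n - 1)
    rw [Nat.sub_add_cancel hspec.1] at h3
    have h4 : m (n - 1) < j := by
      by_contra hcon
      exact h2 ⟨by omega, by omega⟩
    omega

lemma abs_le_mul_two_pow {m : ℕ → ℕ} (hm : Monotone m) {a : ℕ → ℝ} {A : ℝ} (hA : 0 ≤ A)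
    (h1 : |a 1| ≤ A) (hstep : ∀ n, 1 ≤ n → |a (n + 1) - a n| ≤ A * 2 ^ m (n + 1))
    (heq : ∀ n, m (n + 1) = m n → a (n + 1) = a n) {n : ℕ} (hn : 1 ≤ n) :
    |a n| ≤ 2 * A * 2 ^ m n := by
  induction n, hn using Nat.le_induction with
  | base =>
    have : (1 : ℝ) ≤ 2 ^ m 1 := one_le_pow₀ one_le_two
    nlinarith
  | succ n hn ih =>
    obtain h | h := (hm n.le_succ).eq_or_lt
    · rw [heq n h.symm, ← h]
      exact ih
    · have hpow : (2 : ℝ) * 2 ^ m n ≤ 2 ^ m (n + 1) := by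
        rw [← pow_succ']
        exact pow_le_pow_right₀ one_le_two h
      have htri : |a (n + 1)| ≤ |a (n + 1) - a n| + |a n| := by
        simpa using abs_add_le (a (n + 1) - a n) (a n)
      have hA' := mul_le_mul_of_nonneg_left hpow hA
      linarith [hstep n hn]

end Bandwidths

section Kernel

variable {d N : ℕ} {K : 𝔼 (Fin d) → ℝ}

lemma KernelClass.hasCompactSupport (hK : KernelClass d N K) : HasCompactSupport K := hK.1

lemma KernelClass.contDiff (hK : KernelClass d N K) : ContDiff ℝ N K := hK.2.2.2.2.1.1

lemma KernelClass.continuous (hK : KernelClass d N K) : Continuous K := hK.contDiff.continuous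

lemma KernelClass.integrable (hK : KernelClass d N K) : Integrable K :=
  hK.continuous.integrable_of_hasCompactSupport hK.hasCompactSupport

lemma KernelClass.integral_eq_one (hK : KernelClass d N K) : ∫ u, K u = 1 := hK.2.2.2.1

lemma KernelClass.integral_list_prod_mul (hK : KernelClass d N K) {l : List (Fin d)}
    (h1 : 1 ≤ l.length) (hN : l.length ≤ N) :
    ∫ v : 𝔼 (Fin d), (l.map fun i => v i).prod * K v = 0 := by
  classical
  rw [← hK.2.2.2.2.2 (fun i => l.count i) (by rwa [sum_count_eq_length])
    (by rwa [sum_count_eq_length])]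
  congr 1
  funext v
  rw [Finset.prod_list_map_count]
  congr 1
  refine Finset.prod_subset (Finset.subset_univ _) fun i _ hi => ?_
  rw [List.count_eq_zero.2 (by simpa using hi), pow_zero]

end Kernel

section Inclusions

variable {d β : ℕ} {K : 𝔼 (Fin d) → ℝ} {f : 𝔼 (Fin d) → ℝ}

/-- Kernel smoothing of a function in the Hölder class has bias of order `s^β`. -/
lemma HolderSigma.exists_bias_le (hK : KernelClass d (β + 1) K) (hf : HolderSigma d β f) :
    ∃ C : ℝ, ∀ s : ℝ, 0 < s → ∀ t, |convol d (resKer d K s) f t - f t| ≤ C * s ^ β := by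
  obtain ⟨m, hm1, hm2, hfm, -, -, hlip⟩ := hf
  have hβ : β = m + 1 := by
    have h1 : m < β := by exact_mod_cast hm1
    have h2 : β ≤ m + 1 := by exact_mod_cast hm2
    omega
  subst hβ
  obtain ⟨C, hC⟩ := exists_integral_dilate_sub_le m K f hK.continuous hK.hasCompactSupport
    (fun l h1 hl => hK.integral_list_prod_mul h1 (by omega)) hfm fun l hl => by
      obtain ⟨C, hC⟩ := hlip (fun i => l.count i) (by rw [sum_count_eq_length, hl])
      have hperm := directionList_count_perm l
      rw [pderivM_eq_pderivL, pderivL_perm hperm (by rwa [hperm.length_eq, hl])] at hC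
      refine ⟨C, fun x y => (hC x y).trans_eq ?_⟩
      rw [Nat.cast_add_one, add_sub_cancel_left, Real.rpow_one]
  refine ⟨C, fun s hs t => ?_⟩
  rw [convol_resKer_eq K f hs]
  simpa only [hK.integral_eq_one, one_mul] using hC t s hs.le

/-- Applying the kernel smoother twice keeps the approximation rate. -/
lemma ae_abs_sub_convol_convol_le {N : ℕ} (hK : KernelClass d N K) {s M : ℝ} (hs : 0 < s)
    (hf : BddMeas d f) (hbias : ∀ᵐ t, |convol d (resKer d K s) f t - f t| ≤ M) :
    ∀ᵐ t, |f t - convol d (resKer d K s) (convol d (resKer d K s) f) t| ≤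
      ((∫ v, |K v|) + 1) * M := by
  have hPf := bddMeas_convol_resKer hK.continuous hK.hasCompactSupport hf hs
  have hsmooth := abs_convol_resKer_le hK.continuous hK.hasCompactSupport hbias hs
  filter_upwards [hbias] with t ht
  have h := hsmooth t
  rw [convol_sub (integrable_resKer hK.continuous hK.hasCompactSupport hs) hPf hf] at h
  have htri := abs_add_le
    (convol d (resKer d K s) (convol d (resKer d K s) f) t - convol d (resKer d K s) f t)
    (convol d (resKer d K s) f t - f t)
  rw [sub_add_sub_cancel, abs_sub_comm] at htri
  linarith

/-- The derivatives of the twice smoothed functions at two bandwidths differ by a quantity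
controlled by the distance between the once smoothed functions. -/
lemma abs_pderivL_sub_le {N : ℕ} (hK : KernelClass d N K) (hf : BddMeas d f) {a b M : ℝ}
    (ha : 0 < a) (hab : a ≤ b)
    (hM : ∀ᵐ t, |convol d (resKer d K a) f t - convol d (resKer d K b) f t| ≤ M)
    {l : List (Fin d)} (hl : l.length = N) (t : 𝔼 (Fin d)) :
    |pderivL l (convol d (resKer d K a) (convol d (resKer d K a) f)) t -
      pderivL l (convol d (resKer d K b) (convol d (resKer d K b) f)) t| ≤
      2 * ((a ^ N)⁻¹ * ((∫ v, |pderivL l K v|) * M)) := by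
  have hb : 0 < b := ha.trans_le hab
  have hKl : ContDiff ℝ l.length K := hl ▸ hK.contDiff
  have hD : Continuous (pderivL l K) :=
    (ContDiff.pderivL (n := 0) (by simpa using hKl)).continuous
  have hDs := hK.hasCompactSupport.pderivL l
  have hP : ∀ {c : ℝ}, 0 < c → BddMeas d (convol d (resKer d K c) f) := fun hc =>
    bddMeas_convol_resKer hK.continuous hK.hasCompactSupport hf hc
  have hderiv : ∀ {c e : ℝ}, 0 < c → 0 < e →
      pderivL l (convol d (resKer d K c) (convol d (resKer d K e) f)) t =
        (c ^ N)⁻¹ * convol d (resKer d (pderivL l K) c) (convol d (resKer d K e) f) t := by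
    intro c e hc he
    rw [pderivL_convol_resKer (hP he).locallyIntegrable hc l hKl hK.hasCompactSupport, hl]
  have hbound : ∀ {c : ℝ}, a ≤ c →
      |pderivL l (convol d (resKer d K c) (convol d (resKer d K a) f)) t -
        pderivL l (convol d (resKer d K c) (convol d (resKer d K b) f)) t| ≤
      (a ^ N)⁻¹ * ((∫ v, |pderivL l K v|) * M) := by
    intro c hac
    have hc := ha.trans_le hac
    rw [hderiv hc ha, hderiv hc hb, ← mul_sub,
      ← convol_sub (integrable_resKer hD hDs hc) (hP ha) (hP hb), abs_mul,
      abs_of_nonneg (by positivity)]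
    exact mul_le_mul (inv_anti₀ (by positivity) (pow_le_pow_left₀ ha.le hac N))
      (abs_convol_resKer_le hD hDs hM hc t) (abs_nonneg _) (by positivity)
  have h1 := hbound le_rfl
  have h2 := hbound hab
  rw [convol_resKer_comm hK.integrable hK.integrable hf ha hb] at h1
  exact (abs_sub_le _ _ _).trans ((add_le_add h1 h2).trans_eq (two_mul _).symm)

lemma exists_abs_pderivL_le (hK : KernelClass d (β + 1) K) (hf : BddMeas d f) {m : ℕ → ℕ}
    (hm : Monotone m) {B : ℕ} (hB : ∀ n, m (n + 1) - m n ≤ B) {C : ℝ}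
    (hbias : ∀ n, 1 ≤ n →
      ∀ᵐ t, |convol d (resKer d K (2 ^ m n)⁻¹) f t - f t| ≤ C * ((2 ^ m n)⁻¹) ^ β)
    {l : List (Fin d)} (hl : l.length = β + 1) :
    ∃ A : ℝ, ∀ n, 1 ≤ n → ∀ t,
      |pderivL l (convol d (resKer d K (2 ^ m n)⁻¹) (convol d (resKer d K (2 ^ m n)⁻¹) f)) t| ≤
        A * 2 ^ m n := by
  have hpos : ∀ n, (0 : ℝ) < (2 ^ m n)⁻¹ := fun n => by positivity
  have hC : 0 ≤ C := by
    obtain ⟨t, ht⟩ := (hbias 1 le_rfl).exists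
    exact nonneg_of_mul_nonneg_left ((abs_nonneg _).trans ht) (pow_pos (hpos 1) β)
  have hKl : ContDiff ℝ l.length K := hl ▸ hK.contDiff
  have hD : Continuous (pderivL l K) :=
    (ContDiff.pderivL (n := 0) (by simpa using hKl)).continuous
  have hPf := bddMeas_convol_resKer hK.continuous hK.hasCompactSupport hf (hpos 1)
  obtain ⟨M, hM⟩ := hPf.2
  have hM0 : 0 ≤ M := (abs_nonneg _).trans (hM 0)
  set I := ∫ v, |pderivL l K v|
  have hI : 0 ≤ I := integral_nonneg fun _ => abs_nonneg _
  refine ⟨2 * (((((2 ^ m 1)⁻¹) ^ (β + 1))⁻¹ * (I * M)) + 4 * I * C * 2 ^ (B * β)),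
    fun n hn t => ?_⟩
  refine abs_le_mul_two_pow hm (a := fun n => pderivL l (convol d (resKer d K (2 ^ m n)⁻¹)
    (convol d (resKer d K (2 ^ m n)⁻¹) f)) t) (by positivity) ?_ (fun n hn => ?_)
    (fun n h => by simp only [h]) hn
  · rw [pderivL_convol_resKer hPf.locallyIntegrable (hpos 1) l hKl hK.hasCompactSupport, hl,
      abs_mul, abs_of_nonneg (by positivity)]
    refine le_add_of_le_of_nonneg (mul_le_mul_of_nonneg_left ?_ (by positivity)) (by positivity)
    exact abs_convol_resKer_le hD (hK.hasCompactSupport.pderivL l)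
      (Filter.Eventually.of_forall hM) (hpos 1) t
  · have hle : ((2 : ℝ) ^ m (n + 1))⁻¹ ≤ (2 ^ m n)⁻¹ :=
      inv_anti₀ (by positivity) (pow_le_pow_right₀ one_le_two (hm n.le_succ))
    have hdiff : ∀ᵐ t, |convol d (resKer d K (2 ^ m (n + 1))⁻¹) f t -
        convol d (resKer d K (2 ^ m n)⁻¹) f t| ≤ 2 * C * ((2 ^ m n)⁻¹) ^ β := by
      filter_upwards [hbias n hn, hbias (n + 1) (by omega)] with t h1 h2
      have h3 := mul_le_mul_of_nonneg_left (pow_le_pow_left₀ (hpos (n + 1)).le hle β) hC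
      have h4 := abs_sub_le (convol d (resKer d K (2 ^ m (n + 1))⁻¹) f t) (f t)
        (convol d (resKer d K (2 ^ m n)⁻¹) f t)
      rw [abs_sub_comm (f t)] at h4
      exact h4.trans ((add_le_add (h2.trans h3) h1).trans_eq (by ring))
    refine (abs_pderivL_sub_le hK hf (hpos (n + 1)) hle hdiff hl t).trans ?_
    have hexp : ((((2 : ℝ) ^ m (n + 1))⁻¹) ^ (β + 1))⁻¹ * ((2 ^ m n)⁻¹) ^ β ≤
        2 ^ (B * β) * 2 ^ m (n + 1) := by
      rw [inv_pow, inv_pow, inv_inv, pow_succ, mul_right_comm]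
      refine mul_le_mul_of_nonneg_right ?_ (by positivity)
      rw [← div_eq_mul_inv, div_le_iff₀ (by positivity), pow_mul, ← mul_pow, ← pow_add]
      have h := hB n
      exact pow_le_pow_left₀ (by positivity) (pow_le_pow_right₀ one_le_two (by omega)) β
    calc _ = 4 * I * C *
          (((((2 : ℝ) ^ m (n + 1))⁻¹) ^ (β + 1))⁻¹ * ((2 ^ m n)⁻¹) ^ β) := by ring
      _ ≤ 4 * I * C * (2 ^ (B * β) * 2 ^ m (n + 1)) :=
          mul_le_mul_of_nonneg_left hexp (by positivity)
      _ = 4 * I * C * 2 ^ (B * β) * 2 ^ m (n + 1) := by ring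
      _ ≤ _ := mul_le_mul_of_nonneg_right (le_add_of_nonneg_left (by positivity)) (by positivity)

/-- A bounded periodic function that kernel smoothing approximates at rate `h^β` along dyadic
bandwidths with bounded gaps belongs to `B^β_{∞,∞}`. -/
lemma memBesov_of_bias_le (hK : KernelClass d (β + 1) K) (hf : BddMeas d f) (hper : Per1 d f)
    {m : ℕ → ℕ} (hm : Monotone m) (hmt : Filter.Tendsto m Filter.atTop Filter.atTop) {B : ℕ}
    (hB : ∀ n, m (n + 1) - m n ≤ B) {C : ℝ} (hC : 0 ≤ C)
    (hbias : ∀ n, 1 ≤ n →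
      ∀ᵐ t, |convol d (resKer d K (2 ^ m n)⁻¹) f t - f t| ≤ C * ((2 ^ m n)⁻¹) ^ β) :
    MemBesov d β (β + 1) f := by
  have hpos : ∀ n, (0 : ℝ) < (2 ^ m n)⁻¹ := fun n => by positivity
  obtain ⟨R, hR⟩ := exists_bounded_excess hmt hB
  choose ν hν1 hνle hνR using hR
  have hP : ∀ n {g : 𝔼 (Fin d) → ℝ}, BddMeas d g →
      BddMeas d (convol d (resKer d K (2 ^ m n)⁻¹) g) := fun n _ hg =>
    bddMeas_convol_resKer hK.continuous hK.hasCompactSupport hg (hpos n)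
  refine ⟨fun j => convol d (resKer d K (2 ^ m (ν j))⁻¹)
    (convol d (resKer d K (2 ^ m (ν j))⁻¹) f), fun j _ => ⟨(hP _ (hP _ hf)).2,
      per1_convol_resKer K (per1_convol_resKer K hper (hpos _)) (hpos _), ?_⟩, ?_, ?_⟩
  · exact contDiff_convol (ContDiff.resKer (n := ((β + 1 : ℕ) : ℕ∞)) hK.contDiff _)
      (hK.hasCompactSupport.resKer (hpos _)) (hP _ hf).locallyIntegrable
  · refine ⟨((∫ v, |K v|) + 1) * C, fun j _ => supNorm_le_of_ae_abs_le ?_⟩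
    filter_upwards [ae_abs_sub_convol_convol_le hK (hpos _) hf (hbias _ (hν1 j))] with t ht
    refine ht.trans ?_
    have hI : 0 ≤ ∫ v, |K v| := integral_nonneg fun _ => abs_nonneg _
    rw [← mul_assoc]
    refine mul_le_mul_of_nonneg_left ?_ (by positivity)
    rw [Real.rpow_mul zero_le_two, Real.rpow_neg zero_le_two, Real.rpow_natCast, Real.rpow_natCast]
    exact pow_le_pow_left₀ (hpos _).le
      (inv_anti₀ (by positivity) (pow_le_pow_right₀ one_le_two (hνle j))) β
  · have hA := fun α : {α : Fin d → ℕ // ∑ i, α i = β + 1} =>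
      exists_abs_pderivL_le hK hf hm hB hbias ((length_directionList α.1).trans α.2)
    choose A hA using hA
    have : Finite {α : Fin d → ℕ // ∑ i, α i = β + 1} :=
      Set.Finite.to_subtype ((Finset.finite_toSet (Finset.univ.piAntidiag (β + 1))).subset
        fun α (hα : ∑ i, α i = β + 1) => by simpa using hα)
    have := Fintype.ofFinite {α : Fin d → ℕ // ∑ i, α i = β + 1}
    refine ⟨(∑ α, |A α|) * 2 ^ R, fun α hα j _ => supNorm_le_of_ae_abs_le
      (Filter.Eventually.of_forall fun t => ?_)⟩
    rw [pderivM_eq_pderivL]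
    refine (hA ⟨α, hα⟩ _ (hν1 j) t).trans ?_
    have hexp : (2 : ℝ) ^ ((((β + 1 : ℕ) : ℝ) - β) * j) = 2 ^ j := by
      rw [Nat.cast_add_one, add_sub_cancel_left, one_mul, Real.rpow_natCast]
    rw [hexp, mul_assoc, ← pow_add]
    refine mul_le_mul ((le_abs_self _).trans (Finset.single_le_sum (f := fun α => |A α|)
      (fun _ _ => abs_nonneg _) (Finset.mem_univ _))) ?_ (by positivity)
      (Finset.sum_nonneg fun _ _ => abs_nonneg _)
    exact pow_le_pow_right₀ one_le_two ((hνR j).trans_eq (add_comm _ _))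

end Inclusions

/-- Deterministic content of case 2 of Theorem 4, for integer `β` (with `N = β + 1`):
(i) every `f` in the Hölder class `Σ(β)` satisfies `sup_n h_n^{-β} ‖K_{h_n}*f - f‖_∞ < ∞`;
(ii) every bounded measurable 1-periodic `f` with `sup_n h_n^{-β} ‖K_{h_n}*f - f‖_∞ < ∞`
belongs to `B^β_{∞,∞}` in the approximation sense. -/
theorem integer_case_inclusions (d : ℕ) (hd : 1 ≤ d) (β : ℕ) (hβ : 1 ≤ β)
    (K : EuclideanSpace ℝ (Fin d) → ℝ) (hK : KernelClass d (β + 1) K)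
    (h : ℕ → ℝ) (hh : BandClass h) :
    (∀ f : EuclideanSpace ℝ (Fin d) → ℝ, HolderSigma d (β : ℝ) f →
      ∃ C : ℝ, ∀ n : ℕ, 1 ≤ n →
        supNorm d (fun t => convol d (resKer d K (h n)) f t - f t) ≤
          ENNReal.ofReal (C * h n ^ (β : ℝ))) ∧
    (∀ f : EuclideanSpace ℝ (Fin d) → ℝ, BddMeas d f → Per1 d f →
      (∃ C : ℝ, ∀ n : ℕ, 1 ≤ n →
        supNorm d (fun t => convol d (resKer d K (h n)) f t - f t) ≤
          ENNReal.ofReal (C * h n ^ (β : ℝ))) →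
      MemBesov d (β : ℝ) (β + 1) f) := by
  obtain ⟨m, -, hm, hmt, ⟨B, hB⟩, hhm⟩ := hh
  have hpow : ∀ n, h n = (2 ^ m n)⁻¹ := fun n => by
    rw [hhm, Real.rpow_neg zero_le_two, Real.rpow_natCast]
  simp only [hpow, Real.rpow_natCast]
  refine ⟨fun f hf => ?_, fun f hf hper hbias => ?_⟩
  · obtain ⟨C, hC⟩ := hf.exists_bias_le hK
    exact ⟨C, fun n _ => supNorm_le_of_ae_abs_le
      (Filter.Eventually.of_forall (hC _ (by positivity)))⟩
  · obtain ⟨C, hC⟩ := hbias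
    refine memBesov_of_bias_le hK hf hper hm hmt hB (le_max_right C 0) fun n hn => ?_
    refine ae_abs_le_of_supNorm_le (by positivity) ((hC n hn).trans ?_)
    exact ENNReal.ofReal_le_ofReal (mul_le_mul_of_nonneg_right (le_max_left C 0) (by positivity))
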